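/- arXiv:1809.05796 — 2 statements merged into one kernel-verified Lean document; each statement's English description precedes it below -/
import Mathlib

section
/- For every δ ∈ (0,1) there exists a constant C(δ) > 0 such that for all t > 0, all x ∈ [0,π], and all z, h with z, z + h ∈ [0,π] and h > 0, |p(t,x,z+h) − p(t,x,z)| ≤ C(δ) h^δ t^{-(1+δ)/2}. -/
open Real Set

/-- The Dirichlet heat kernel on `[0, π]`. -/
noncomputable def heatKernel (t x y : ℝ) : ℝ :=
  (2 / Real.pi) * ∑' k : ℕ+, Real.exp (-(k : ℝ) ^ 2 * t) * Real.sin (k * x) * Real.sin (k * y)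

theorem abs_sin_sub_sin_le_two_mul_rpow {δ : ℝ} (hδ₀ : 0 ≤ δ) (hδ₁ : δ ≤ 1) (a b : ℝ) :
    |sin a - sin b| ≤ 2 * |a - b| ^ δ := by
  rcases le_total 1 |a - b| with h | h
  · have h₁ : 1 ≤ |a - b| ^ δ := one_le_rpow h hδ₀
    have h₂ : |sin a - sin b| ≤ 2 := by
      rw [abs_le]
      constructor <;> linarith [sin_le_one a, sin_le_one b, neg_one_le_sin a, neg_one_le_sin b]
    linarith
  · have h₁ : |a - b| ^ (1 : ℝ) ≤ |a - b| ^ δ :=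
      rpow_le_rpow_of_exponent_ge' (abs_nonneg _) h hδ₀ hδ₁
    rw [rpow_one] at h₁
    have h₂ : |sin a - sin b| ≤ |a - b| := abs_sin_sub_sin_le a b
    linarith [abs_nonneg (a - b)]

theorem rpow_le_two_mul_exp_sq_half {δ s : ℝ} (hδ₀ : 0 ≤ δ) (hδ₁ : δ ≤ 1) (hs : 0 ≤ s) :
    s ^ δ ≤ 2 * exp (s ^ 2 / 2) := by
  have h₁ : s ^ δ ≤ 1 + s := by
    rcases le_total s 1 with h | h
    · linarith [rpow_le_one hs h hδ₀]
    · have := rpow_le_rpow_of_exponent_le h hδ₁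
      rw [rpow_one] at this
      linarith
  nlinarith [add_one_le_exp (s ^ 2 / 2), sq_nonneg (s - 1)]

theorem sum_range_exp_neg_mul_sq_le {a : ℝ} (ha : 0 < a) (n : ℕ) :
    ∑ k ∈ Finset.range n, exp (-a * ((k + 1 : ℕ) : ℝ) ^ 2) ≤ √(π / a) / 2 := by
  have hanti : AntitoneOn (fun x : ℝ => exp (-a * x ^ 2)) (Icc 0 (0 + (n : ℝ))) := by
    intro x hx y _ hxy
    have : x ^ 2 ≤ y ^ 2 := pow_le_pow_left₀ hx.1 hxy 2
    exact exp_le_exp.2 (by nlinarith)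
  have hsum := hanti.sum_le_integral
  simp only [zero_add] at hsum
  rw [intervalIntegral.integral_of_le (Nat.cast_nonneg n)] at hsum
  rw [← integral_gaussian_Ioi a]
  refine hsum.trans (MeasureTheory.setIntegral_mono_set
    (integrable_exp_neg_mul_sq ha).integrableOn ?_ ?_)
  · exact Filter.Eventually.of_forall fun x => (exp_pos _).le
  · exact Ioc_subset_Ioi_self.eventuallyLE

theorem summable_pnat_exp_neg_mul_sq {a : ℝ} (ha : 0 < a) :
    Summable fun k : ℕ+ => exp (-a * (k : ℝ) ^ 2) :=
  (summable_pnat_iff_summable_succ (f := fun k : ℕ => exp (-a * (k : ℝ) ^ 2))).2 <|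
    summable_of_sum_range_le (fun _ => (exp_pos _).le) (sum_range_exp_neg_mul_sq_le ha)

theorem tsum_pnat_exp_neg_mul_sq_le {a : ℝ} (ha : 0 < a) :
    ∑' k : ℕ+, exp (-a * (k : ℝ) ^ 2) ≤ √(π / a) / 2 := by
  rw [tsum_pnat_eq_tsum_succ (f := fun k : ℕ => exp (-a * (k : ℝ) ^ 2))]
  exact Real.tsum_le_of_sum_range_le (fun _ => (exp_pos _).le) (sum_range_exp_neg_mul_sq_le ha)

theorem summable_heatKernel_term {t : ℝ} (ht : 0 < t) (x y : ℝ) :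
    Summable fun k : ℕ+ => exp (-(k : ℝ) ^ 2 * t) * sin (k * x) * sin (k * y) := by
  refine (summable_pnat_exp_neg_mul_sq ht).of_norm_bounded fun k => ?_
  rw [norm_mul, norm_mul, norm_eq_abs, abs_exp, norm_eq_abs, norm_eq_abs,
    show -(k : ℝ) ^ 2 * t = -t * (k : ℝ) ^ 2 by ring, mul_assoc]
  exact mul_le_of_le_one_right (exp_pos _).le
    (mul_le_one₀ (abs_sin_le_one _) (abs_nonneg _) (abs_sin_le_one _))

theorem abs_heatKernel_term_sub_le {δ t h : ℝ} (hδ₀ : 0 ≤ δ) (hδ₁ : δ ≤ 1) (ht : 0 < t)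
    (hh : 0 ≤ h) (x z : ℝ) {k : ℝ} (hk : 0 ≤ k) :
    |exp (-k ^ 2 * t) * sin (k * x) * sin (k * (z + h)) -
        exp (-k ^ 2 * t) * sin (k * x) * sin (k * z)| ≤
      4 * h ^ δ * t ^ (-δ / 2) * exp (-(t / 2) * k ^ 2) := by
  have hsin : |sin (k * (z + h)) - sin (k * z)| ≤ 2 * (k ^ δ * h ^ δ) := by
    have := abs_sin_sub_sin_le_two_mul_rpow hδ₀ hδ₁ (k * (z + h)) (k * z)
    rwa [show k * (z + h) - k * z = k * h by ring, abs_of_nonneg (mul_nonneg hk hh),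
      mul_rpow hk hh] at this
  have hpow : k ^ δ ≤ t ^ (-δ / 2) * (2 * exp (k ^ 2 * t / 2)) := by
    have hs := rpow_le_two_mul_exp_sq_half hδ₀ hδ₁ (mul_nonneg hk (sqrt_nonneg t))
    rw [mul_pow, sq_sqrt ht.le, mul_rpow hk (sqrt_nonneg t), sqrt_eq_rpow, ← rpow_mul ht.le] at hs
    have hcancel : t ^ (-δ / 2) * t ^ (1 / 2 * δ) = 1 := by
      rw [← rpow_add ht, show -δ / 2 + 1 / 2 * δ = 0 by ring, rpow_zero]
    calc k ^ δ = t ^ (-δ / 2) * (k ^ δ * t ^ (1 / 2 * δ)) := by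
          linear_combination -(k ^ δ) * hcancel
      _ ≤ _ := by gcongr
  have hexp : exp (-k ^ 2 * t) * exp (k ^ 2 * t / 2) = exp (-(t / 2) * k ^ 2) := by
    rw [← exp_add]
    ring_nf
  rw [← mul_sub, abs_mul, abs_mul, abs_exp]
  calc exp (-k ^ 2 * t) * |sin (k * x)| * |sin (k * (z + h)) - sin (k * z)|
      ≤ exp (-k ^ 2 * t) * 1 * (2 * ((t ^ (-δ / 2) * (2 * exp (k ^ 2 * t / 2))) * h ^ δ)) := by
        gcongr
        · exact abs_sin_le_one _
        · exact hsin.trans (by gcongr)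
    _ = 4 * h ^ δ * t ^ (-δ / 2) * (exp (-k ^ 2 * t) * exp (k ^ 2 * t / 2)) := by ring
    _ = _ := by rw [hexp]

/-- For every `δ ∈ (0,1)` there is `C(δ) > 0` such that for all `t > 0`, `x ∈ [0,π]`,
and `z, h` with `z, z + h ∈ [0,π]`, `h > 0`:
`|p(t,x,z+h) − p(t,x,z)| ≤ C(δ) h^δ t^{-(1+δ)/2}`. -/
theorem heatKernel_holder (δ : ℝ) (hδ : δ ∈ Ioo (0 : ℝ) 1) :
    ∃ C : ℝ, 0 < C ∧ ∀ t : ℝ, 0 < t → ∀ x ∈ Icc (0 : ℝ) Real.pi, ∀ z h : ℝ,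
      z ∈ Icc (0 : ℝ) Real.pi → z + h ∈ Icc (0 : ℝ) Real.pi → 0 < h →
      |heatKernel t x (z + h) - heatKernel t x z| ≤ C * h ^ δ * t ^ (-(1 + δ) / 2) := by
  refine ⟨2 / π * 4 * (√(2 * π) / 2), by positivity, fun t ht x _ z h _ _ hh => ?_⟩
  have ht₂ : 0 < t / 2 := half_pos ht
  have hsqrt : √(π / (t / 2)) = √(2 * π) * t ^ (-1 / 2 : ℝ) := by
    rw [show π / (t / 2) = 2 * π * t⁻¹ by field_simp, sqrt_mul (by positivity),
      sqrt_eq_rpow t⁻¹, inv_rpow ht.le, ← rpow_neg ht.le]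
    norm_num
  have hpow : t ^ (-δ / 2) * t ^ (-1 / 2 : ℝ) = t ^ (-(1 + δ) / 2) := by
    rw [← rpow_add ht]
    ring_nf
  have hsum := tsum_of_norm_bounded
    (f := fun k : ℕ+ => exp (-(k : ℝ) ^ 2 * t) * sin (k * x) * sin (k * (z + h)) -
      exp (-(k : ℝ) ^ 2 * t) * sin (k * x) * sin (k * z))
    ((summable_pnat_exp_neg_mul_sq ht₂).hasSum.mul_left (4 * h ^ δ * t ^ (-δ / 2)))
    fun k : ℕ+ => abs_heatKernel_term_sub_le hδ.1.le hδ.2.le ht hh.le x z (Nat.cast_nonneg (k : ℕ))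
  rw [(summable_heatKernel_term ht x (z + h)).tsum_sub (summable_heatKernel_term ht x z),
    norm_eq_abs] at hsum
  rw [heatKernel, heatKernel, ← mul_sub, abs_mul, abs_of_pos (by positivity : 0 < 2 / π)]
  calc _ ≤ 2 / π * (4 * h ^ δ * t ^ (-δ / 2) * (√(π / (t / 2)) / 2)) := by
        gcongr
        exact hsum.trans (by gcongr; exact tsum_pnat_exp_neg_mul_sq_le ht₂)
    _ = 2 / π * 4 * (√(2 * π) / 2) * h ^ δ * (t ^ (-δ / 2) * t ^ (-1 / 2 : ℝ)) := by
        rw [hsqrt]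
        ring
    _ = _ := by rw [hpow]
end

section
/- For every t > 0 and all x, y ∈ [0,π], p(t,x,y) ≥ 0. -/
open Real Set

open Filter Topology

/-- The reciprocal `1 / ((1 - Q) ⋯ (1 - Q ^ n))` of the `q`-Pochhammer symbol, extended by zero
to negative `n`. -/
noncomputable def qPochhammerInv (Q : ℝ) : ℤ → ℝ
  | .ofNat n => ∏ j ∈ Finset.range n, (1 - Q ^ (j + 1))⁻¹
  | .negSucc _ => 0

lemma qPochhammerInv_natCast (Q : ℝ) (n : ℕ) :
    qPochhammerInv Q n = ∏ j ∈ Finset.range n, (1 - Q ^ (j + 1))⁻¹ := rfl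

lemma qPochhammerInv_of_neg (Q : ℝ) {n : ℤ} (hn : n < 0) : qPochhammerInv Q n = 0 := by
  obtain ⟨m, rfl⟩ := Int.eq_negSucc_of_lt_zero hn
  rfl

section

variable {Q : ℝ}

lemma one_sub_pow_succ_pos (h0 : 0 < Q) (h1 : Q < 1) (n : ℕ) : 0 < 1 - Q ^ (n + 1) :=
  sub_pos.2 (pow_lt_one₀ h0.le h1 n.succ_ne_zero)

lemma qPochhammerInv_sub_one (h0 : 0 < Q) (h1 : Q < 1) (n : ℤ) :
    qPochhammerInv Q (n - 1) = (1 - Q ^ n) * qPochhammerInv Q n := by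
  rcases lt_trichotomy n 0 with hn | rfl | hn
  · rw [qPochhammerInv_of_neg Q hn, qPochhammerInv_of_neg Q (by lia), mul_zero]
  · simp [qPochhammerInv_of_neg Q (show (-1 : ℤ) < 0 by lia)]
  · obtain ⟨m, rfl⟩ : ∃ m : ℕ, n = (m + 1 : ℕ) := ⟨(n - 1).toNat, by lia⟩
    have hm := (one_sub_pow_succ_pos h0 h1 m).ne'
    rw [show ((m + 1 : ℕ) : ℤ) - 1 = (m : ℕ) by push_cast; ring, qPochhammerInv_natCast,
      qPochhammerInv_natCast, Finset.prod_range_succ, zpow_natCast]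
    field_simp

lemma qPochhammerInv_nonneg (h0 : 0 < Q) (h1 : Q < 1) (n : ℤ) : 0 ≤ qPochhammerInv Q n := by
  cases n with
  | ofNat n => exact Finset.prod_nonneg fun j _ ↦ (inv_pos.2 (one_sub_pow_succ_pos h0 h1 j)).le
  | negSucc n => exact le_rfl

lemma qPochhammerInv_monotone (h0 : 0 < Q) (h1 : Q < 1) : Monotone (qPochhammerInv Q) := by
  refine monotone_int_of_le_succ fun n ↦ ?_
  rcases lt_or_ge n 0 with hn | hn
  · rw [qPochhammerInv_of_neg Q hn]
    exact qPochhammerInv_nonneg h0 h1 _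
  · have h := qPochhammerInv_sub_one h0 h1 (n + 1)
    rw [add_sub_cancel_right] at h
    rw [h]
    refine mul_le_of_le_one_left (qPochhammerInv_nonneg h0 h1 _) ?_
    have := zpow_pos h0 (n + 1)
    linarith

lemma qPochhammerInv_natCast_le_exp (h0 : 0 < Q) (h1 : Q < 1) (n : ℕ) :
    qPochhammerInv Q n ≤ exp ((1 - Q ^ n) / (1 - Q) ^ 2) := by
  have h2 : 0 < 1 - Q := sub_pos.2 h1
  induction n with
  | zero => rw [qPochhammerInv_natCast]; simp
  | succ n ih =>
    have hn := one_sub_pow_succ_pos h0 h1 n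
    have hfactor : (1 - Q ^ (n + 1))⁻¹ ≤ exp (Q ^ n / (1 - Q)) := by
      refine le_trans ?_ (add_one_le_exp _)
      rw [inv_le_iff_one_le_mul₀ hn]
      have hQn : Q ^ (n + 1) ≤ Q := pow_le_of_le_one h0.le h1.le n.succ_ne_zero
      have hQn' : Q ^ (n + 1) ≤ Q ^ n := pow_le_pow_of_le_one h0.le h1.le n.le_succ
      have hle : Q ^ n ≤ Q ^ n / (1 - Q) * (1 - Q ^ (n + 1)) := by
        rw [div_mul_eq_mul_div, le_div_iff₀ h2]
        gcongr
      linarith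
    rw [qPochhammerInv_natCast, Finset.prod_range_succ, ← qPochhammerInv_natCast]
    calc _ ≤ exp ((1 - Q ^ n) / (1 - Q) ^ 2) * exp (Q ^ n / (1 - Q)) :=
          mul_le_mul ih hfactor (inv_pos.2 hn).le (exp_pos _).le
      _ = _ := by
          rw [← exp_add]
          congr 1
          field_simp
          ring

lemma qPochhammerInv_le (h0 : 0 < Q) (h1 : Q < 1) (n : ℤ) :
    qPochhammerInv Q n ≤ exp (1 / (1 - Q) ^ 2) := by
  refine (qPochhammerInv_monotone h0 h1 (Int.self_le_toNat n)).trans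
    ((qPochhammerInv_natCast_le_exp h0 h1 _).trans ?_)
  gcongr
  have := pow_pos h0 n.toNat
  linarith

lemma exists_tendsto_qPochhammerInv (h0 : 0 < Q) (h1 : Q < 1) :
    ∃ L, 0 < L ∧ Tendsto (qPochhammerInv Q) atTop (𝓝 L) := by
  have hbdd : BddAbove (range (qPochhammerInv Q)) :=
    ⟨_, forall_mem_range.2 (qPochhammerInv_le h0 h1)⟩
  refine ⟨_, ?_, tendsto_atTop_ciSup (qPochhammerInv_monotone h0 h1) hbdd⟩
  refine lt_of_lt_of_le ?_ (le_ciSup hbdd 0)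
  have h : qPochhammerInv Q 0 = 1 := Finset.prod_range_zero _
  rw [h]
  exact one_pos

end

/-- The coefficients of the finite form of the Jacobi triple product. -/
noncomputable def thetaCoeff (q : ℝ) (N k : ℤ) : ℝ :=
  q ^ (k ^ 2) * (qPochhammerInv (q ^ 2) (N + k) * qPochhammerInv (q ^ 2) (N - k))

section

variable {q : ℝ}

lemma thetaCoeff_eq_zero (q : ℝ) {N k : ℤ} (hk : k ∉ Finset.Icc (-N) N) :
    thetaCoeff q N k = 0 := by
  rw [Finset.mem_Icc, not_and_or] at hk
  rcases hk with hk | hk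
  · rw [thetaCoeff, qPochhammerInv_of_neg _ (show N + k < 0 by lia), zero_mul, mul_zero]
  · rw [thetaCoeff, qPochhammerInv_of_neg _ (show N - k < 0 by lia), mul_zero, mul_zero]

lemma thetaCoeff_add_one (h0 : 0 < q) (h1 : q < 1) (N k : ℤ) :
    (1 - (q ^ 2) ^ (2 * N + 2)) * (1 - (q ^ 2) ^ (2 * N + 1)) * thetaCoeff q (N + 1) k =
      (1 + (q ^ (2 * N + 1)) ^ 2) * thetaCoeff q N k + q ^ (2 * N + 1) * thetaCoeff q N (k - 1) +
        q ^ (2 * N + 1) * thetaCoeff q N (k + 1) := by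
  have hq := h0.ne'
  have hQ0 : 0 < q ^ 2 := pow_pos h0 2
  have hQ1 : q ^ 2 < 1 := pow_lt_one₀ h0.le h1 two_ne_zero
  have e1 := qPochhammerInv_sub_one hQ0 hQ1 (N + 1 + k)
  have e2 := qPochhammerInv_sub_one hQ0 hQ1 (N + k)
  have e3 := qPochhammerInv_sub_one hQ0 hQ1 (N + 1 - k)
  have e4 := qPochhammerInv_sub_one hQ0 hQ1 (N - k)
  rw [show N + 1 + k - 1 = N + k by ring] at e1
  rw [show N + 1 - k - 1 = N - k by ring] at e3
  unfold thetaCoeff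
  rw [show N + (k - 1) = N + k - 1 by ring, show N - (k - 1) = N + 1 - k by ring,
    show N + (k + 1) = N + 1 + k by ring, show N - (k + 1) = N - k - 1 by ring, e2, e4, e1, e3]
  generalize qPochhammerInv (q ^ 2) (N + 1 + k) = u
  generalize qPochhammerInv (q ^ 2) (N + 1 - k) = v
  have f1 : q ^ (2 * N + 1) * q ^ ((k - 1) ^ 2) = q ^ (k ^ 2) * (q ^ 2 * (q ^ 2) ^ (N - k)) := by
    rw [← zpow_natCast q 2, ← zpow_mul, ← zpow_add₀ hq, ← zpow_add₀ hq, ← zpow_add₀ hq]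
    congr 1; push_cast; ring
  have f2 : q ^ (2 * N + 1) * q ^ ((k + 1) ^ 2) = q ^ (k ^ 2) * (q ^ 2 * (q ^ 2) ^ (N + k)) := by
    rw [← zpow_natCast q 2, ← zpow_mul, ← zpow_add₀ hq, ← zpow_add₀ hq, ← zpow_add₀ hq]
    congr 1; push_cast; ring
  have f3 : (q ^ (2 * N + 1)) ^ 2 = (q ^ 2) ^ (2 * N + 1) := by
    rw [← zpow_natCast, ← zpow_natCast, ← zpow_mul, ← zpow_mul, mul_comm]
  rw [← mul_assoc (q ^ (2 * N + 1)), ← mul_assoc (q ^ (2 * N + 1)), f1, f2, f3]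
  have hQ := hQ0.ne'
  generalize q ^ 2 = Q at hQ ⊢
  have g1 : Q ^ (2 * N + 1) = Q * Q ^ (N + k) * Q ^ (N - k) := by
    rw [← zpow_one_add₀ hQ, ← zpow_add₀ hQ]
    congr 1; ring
  have g2 : Q ^ (2 * N + 2) = Q * Q * Q ^ (N + k) * Q ^ (N - k) := by
    rw [mul_assoc Q Q, ← zpow_one_add₀ hQ, mul_assoc, ← zpow_add₀ hQ, ← zpow_one_add₀ hQ]
    congr 1; ring
  rw [g1, g2, show N + 1 + k = 1 + (N + k) by ring, show N + 1 - k = 1 + (N - k) by ring,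
    zpow_one_add₀ hQ, zpow_one_add₀ hQ]
  ring

lemma summable_thetaCoeff_mul (q : ℝ) (N : ℤ) (f : ℤ → ℝ) :
    Summable fun k ↦ thetaCoeff q N k * f k :=
  summable_of_ne_finset_zero (s := Finset.Icc (-N) N) fun k hk ↦ by
    rw [thetaCoeff_eq_zero q hk, zero_mul]

/-- The finite approximations, up to a normalization, of the Jacobi theta function. -/
noncomputable def thetaApprox (q : ℝ) (N : ℤ) (z : ℝ) : ℝ :=
  ∑' k : ℤ, thetaCoeff q N k * cos (k * z)

lemma thetaApprox_add_one (h0 : 0 < q) (h1 : q < 1) (N : ℤ) (z : ℝ) :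
    (1 - (q ^ 2) ^ (2 * N + 2)) * (1 - (q ^ 2) ^ (2 * N + 1)) * thetaApprox q (N + 1) z =
      (1 + 2 * q ^ (2 * N + 1) * cos z + (q ^ (2 * N + 1)) ^ 2) * thetaApprox q N z := by
  set r := q ^ (2 * N + 1)
  have hs (f : ℤ → ℝ) := summable_thetaCoeff_mul q N f
  have hsub : Summable fun k : ℤ ↦ thetaCoeff q N (k - 1) * cos (k * z) := by
    simpa [Function.comp_def] using
      (Equiv.subRight (1 : ℤ)).summable_iff.2 (hs fun k ↦ cos ((k + 1) * z))
  have hadd : Summable fun k : ℤ ↦ thetaCoeff q N (k + 1) * cos (k * z) := by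
    simpa [Function.comp_def] using
      (Equiv.addRight (1 : ℤ)).summable_iff.2 (hs fun k ↦ cos ((k - 1) * z))
  have esub : ∑' k : ℤ, thetaCoeff q N (k - 1) * cos (k * z) =
      ∑' k : ℤ, thetaCoeff q N k * cos ((k + 1) * z) := by
    simpa using (Equiv.subRight (1 : ℤ)).tsum_eq fun k ↦ thetaCoeff q N k * cos ((k + 1) * z)
  have eadd : ∑' k : ℤ, thetaCoeff q N (k + 1) * cos (k * z) =
      ∑' k : ℤ, thetaCoeff q N k * cos ((k - 1) * z) := by
    simpa using (Equiv.addRight (1 : ℤ)).tsum_eq fun k ↦ thetaCoeff q N k * cos ((k - 1) * z)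
  have ecos : ∑' k : ℤ, thetaCoeff q N k * cos ((k + 1) * z) +
      ∑' k : ℤ, thetaCoeff q N k * cos ((k - 1) * z) = 2 * cos z * thetaApprox q N z := by
    rw [← (hs _).tsum_add (hs _), thetaApprox, ← tsum_mul_left]
    refine tsum_congr fun k ↦ ?_
    rw [add_mul, sub_mul, one_mul, cos_add, cos_sub]
    ring
  calc _ = ∑' k : ℤ, ((1 + r ^ 2) * (thetaCoeff q N k * cos (k * z)) +
        r * (thetaCoeff q N (k - 1) * cos (k * z)) +
        r * (thetaCoeff q N (k + 1) * cos (k * z))) := by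
        rw [thetaApprox, ← tsum_mul_left]
        refine tsum_congr fun k ↦ ?_
        rw [← mul_assoc, thetaCoeff_add_one h0 h1]
        ring
    _ = (1 + r ^ 2) * thetaApprox q N z + r * (2 * cos z * thetaApprox q N z) := by
        rw [(((hs _).mul_left _).add (hsub.mul_left _)).tsum_add (hadd.mul_left _),
          ((hs _).mul_left _).tsum_add (hsub.mul_left _), tsum_mul_left, tsum_mul_left,
          tsum_mul_left, esub, eadd, ← ecos, thetaApprox]
        ring
    _ = _ := by ring

lemma thetaApprox_zero (q z : ℝ) : thetaApprox q 0 z = 1 := by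
  rw [thetaApprox, tsum_eq_single 0]
  · have h : qPochhammerInv (q ^ 2) 0 = 1 := Finset.prod_range_zero _
    simp [thetaCoeff, h]
  · intro k hk
    rw [thetaCoeff_eq_zero q (by simpa using hk), zero_mul]

lemma thetaApprox_nonneg_and_le (h0 : 0 < q) (h1 : q < 1) {z w : ℝ} (h : cos z ≤ cos w) (N : ℕ) :
    0 ≤ thetaApprox q N z ∧ thetaApprox q N z ≤ thetaApprox q N w := by
  induction N with
  | zero => simp [thetaApprox_zero]
  | succ N ih =>
    have hQ0 : 0 < q ^ 2 := pow_pos h0 2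
    have hQ1 : q ^ 2 < 1 := pow_lt_one₀ h0.le h1 two_ne_zero
    have hpos : 0 < (1 - (q ^ 2) ^ (2 * (N : ℤ) + 2)) * (1 - (q ^ 2) ^ (2 * (N : ℤ) + 1)) := by
      have ha := one_sub_pow_succ_pos hQ0 hQ1 (2 * N + 1)
      have hb := one_sub_pow_succ_pos hQ0 hQ1 (2 * N)
      exact_mod_cast mul_pos ha hb
    have hz := thetaApprox_add_one h0 h1 N z
    have hw := thetaApprox_add_one h0 h1 N w
    have hr : 0 < q ^ (2 * (N : ℤ) + 1) := zpow_pos h0 _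
    set r := q ^ (2 * (N : ℤ) + 1)
    have hfz : 0 ≤ 1 + 2 * r * cos z + r ^ 2 := by
      nlinarith [sq_nonneg (1 - r), neg_one_le_cos z]
    have hfzw : 1 + 2 * r * cos z + r ^ 2 ≤ 1 + 2 * r * cos w + r ^ 2 := by gcongr
    push_cast
    constructor
    · refine nonneg_of_mul_nonneg_right (b := thetaApprox q (N + 1) z) ?_ hpos
      rw [hz]
      exact mul_nonneg hfz ih.1
    · refine le_of_mul_le_mul_left ?_ hpos
      rw [hz, hw]
      exact mul_le_mul hfzw ih.2 ih.1 (hfz.trans hfzw)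

lemma summable_zpow_sq (h0 : 0 < q) (h1 : q < 1) : Summable fun k : ℤ ↦ q ^ (k ^ 2) := by
  have hnat : Summable fun n : ℕ ↦ q ^ ((n : ℤ) ^ 2) := by
    refine (summable_geometric_of_lt_one h0.le h1).of_nonneg_of_le
      (fun n ↦ (zpow_pos h0 _).le) fun n ↦ ?_
    rw [← Nat.cast_pow, zpow_natCast]
    exact pow_le_pow_of_le_one h0.le h1.le (Nat.le_self_pow two_ne_zero n)
  exact Summable.of_nat_of_neg (f := fun k : ℤ ↦ q ^ (k ^ 2)) hnat
    (by simpa only [neg_sq] using hnat)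

lemma summable_zpow_sq_mul_cos (h0 : 0 < q) (h1 : q < 1) (z : ℝ) :
    Summable fun k : ℤ ↦ q ^ (k ^ 2) * cos (k * z) := by
  refine (summable_zpow_sq h0 h1).of_norm_bounded fun k ↦ ?_
  rw [norm_mul, norm_of_nonneg (zpow_pos h0 _).le]
  exact mul_le_of_le_one_right (zpow_pos h0 _).le (abs_cos_le_one _)

lemma exists_tendsto_thetaApprox (h0 : 0 < q) (h1 : q < 1) :
    ∃ L, 0 < L ∧ ∀ z, Tendsto (fun N : ℕ ↦ thetaApprox q N z) atTop
      (𝓝 (L * ∑' k : ℤ, q ^ (k ^ 2) * cos (k * z))) := by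
  have hQ0 : 0 < q ^ 2 := pow_pos h0 2
  have hQ1 : q ^ 2 < 1 := pow_lt_one₀ h0.le h1 two_ne_zero
  obtain ⟨L, hL, hlim⟩ := exists_tendsto_qPochhammerInv hQ0 hQ1
  refine ⟨L * L, mul_pos hL hL, fun z ↦ ?_⟩
  set C := exp (1 / (1 - q ^ 2) ^ 2)
  rw [← tsum_mul_left]
  refine tendsto_tsum_of_dominated_convergence (bound := fun k : ℤ ↦ q ^ (k ^ 2) * (C * C))
    ((summable_zpow_sq h0 h1).mul_right _) (fun k ↦ ?_) (Eventually.of_forall fun N k ↦ ?_)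
  · have hcast : Tendsto (fun N : ℕ ↦ (N : ℤ)) atTop atTop := tendsto_natCast_atTop_atTop
    have hp := hlim.comp (tendsto_atTop_add_const_right _ k hcast)
    have hm := hlim.comp (tendsto_atTop_add_const_right _ (-k) hcast)
    rw [show L * L * (q ^ (k ^ 2) * cos (k * z)) = q ^ (k ^ 2) * (L * L) * cos (k * z) by ring]
    exact ((hp.mul hm).const_mul (q ^ (k ^ 2))).mul_const (cos (k * z))
  · have hp := qPochhammerInv_nonneg hQ0 hQ1 (N + k)
    have hm := qPochhammerInv_nonneg hQ0 hQ1 (N - k)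
    have hk := (zpow_pos h0 (k ^ 2)).le
    rw [norm_mul, thetaCoeff, norm_of_nonneg (mul_nonneg hk (mul_nonneg hp hm))]
    refine (mul_le_of_le_one_right (mul_nonneg hk (mul_nonneg hp hm)) (abs_cos_le_one _)).trans ?_
    gcongr
    · exact qPochhammerInv_le hQ0 hQ1 _
    · exact qPochhammerInv_le hQ0 hQ1 _

/-- The theta function `∑ q ^ (k ^ 2) cos (k z)` is a monotone function of `cos z`. -/
lemma tsum_zpow_sq_mul_cos_le (h0 : 0 < q) (h1 : q < 1) {z w : ℝ} (h : cos z ≤ cos w) :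
    ∑' k : ℤ, q ^ (k ^ 2) * cos (k * z) ≤ ∑' k : ℤ, q ^ (k ^ 2) * cos (k * w) := by
  obtain ⟨L, hL, hlim⟩ := exists_tendsto_thetaApprox h0 h1
  exact le_of_mul_le_mul_left (le_of_tendsto_of_tendsto' (hlim z) (hlim w)
    fun N ↦ (thetaApprox_nonneg_and_le h0 h1 h N).2) hL

end

/-- For every `t > 0` and all `x, y ∈ [0, π]`, `p(t,x,y) ≥ 0`. -/
theorem heatKernel_nonneg (t : ℝ) (ht : 0 < t) (x y : ℝ)
    (hx : x ∈ Icc (0 : ℝ) Real.pi) (hy : y ∈ Icc (0 : ℝ) Real.pi) :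
    0 ≤ heatKernel t x y := by
  have h0 : 0 < exp (-t) := exp_pos _
  have h1 : exp (-t) < 1 := exp_lt_one_iff.2 (by linarith)
  have hcos : cos (x + y) ≤ cos (x - y) := by
    rw [cos_add, cos_sub]
    linarith [mul_nonneg (sin_nonneg_of_mem_Icc hx) (sin_nonneg_of_mem_Icc hy)]
  have hle := sub_nonneg.2 (tsum_zpow_sq_mul_cos_le h0 h1 hcos)
  have hsp := summable_zpow_sq_mul_cos h0 h1 (x + y)
  have hsm := summable_zpow_sq_mul_cos h0 h1 (x - y)
  set f : ℤ → ℝ := fun k ↦ exp (-(k : ℝ) ^ 2 * t) * sin (k * x) * sin (k * y) with hf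
  have hterm (k : ℤ) : exp (-t) ^ (k ^ 2) * cos (k * (x - y)) -
      exp (-t) ^ (k ^ 2) * cos (k * (x + y)) = 2 * f k := by
    have hexp : exp (-t) ^ (k ^ 2) = exp (-(k : ℝ) ^ 2 * t) := by
      rw [← rpow_intCast, ← exp_mul]
      push_cast
      ring_nf
    rw [hexp, mul_sub, mul_add, cos_add, cos_sub]
    ring
  have hsf : Summable f := by
    have := (hsm.sub hsp).congr hterm
    exact (summable_mul_left_iff two_ne_zero).1 this
  rw [← hsm.tsum_sub hsp, tsum_congr hterm, tsum_mul_left,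
    tsum_int_eq_zero_add_two_mul_tsum_pnat (fun k ↦ by simp [hf]) hsf] at hle
  have hf0 : f 0 = 0 := by simp [hf]
  rw [hf0, zero_add, nsmul_eq_mul] at hle
  simp only [hf, Int.cast_natCast] at hle
  refine mul_nonneg (by positivity) ?_
  push_cast at hle
  linarith
end
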